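/- arXiv:1511.08477 — 6 statements merged into one kernel-verified Lean document; each statement's English description precedes it below -/
import Mathlib

section
/- Let B be a left brace, let I be an ideal of B whose induced brace structure is trivial (i.e. y₁·y₂ = y₁+y₂ for all y₁,y₂ ∈ I), let H = B/I, and let s : H → B be a map with π∘s = id and s(0) = 0, where π : B → H is the natural projection. For x ∈ H and y ∈ I define σ_x(y) := s(x)⁻¹·y·s(x). Then each σ_x is an automorphism of (I,+), and σ_{x₁}(σ_{x₂}(y)) = σ_{x₂·x₁}(y) for all x₁,x₂ ∈ H and y ∈ I; that is, σ is а right action of (H,·) on (I,+). -/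
/-- A left brace: a set `B` with an abelian group structure `(B,+)` and a group
structure `(B,·)` such that `a·(b+c)+a = a·b+a·c` for all `a,b,c`. -/
class LeftBrace (B : Type*) extends AddCommGroup B, Group B where
  brace_law : ∀ a b c : B, a * (b + c) + a = a * b + a * c

/-- Let `B` be a left brace, `I` an ideal of `B` (a normal subgroup of `(B,·)` closed
under all lambda maps `λ_b(x) = b·x − b`) whose induced brace structure is trivial, let
`H = B/I` (presented by a surjective brace morphism `π : B → H` with kernel `I`), and
let `s : H → B` be a section with `π∘s = id` and `s(0) = 0`.  For `x ∈ H`, `y ∈ I` set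
`σ_x(y) := s(x)⁻¹·y·s(x)`.  Then each `σ_x` is an automorphism of `(I,+)` and
`σ_{x₁}∘σ_{x₂} = σ_{x₂·x₁}`, i.e. `σ` is a right action of `(H,·)` on `(I,+)`. -/
theorem stmt5 (B H : Type*) [LeftBrace B] [LeftBrace H]
    (I : Subgroup B) (hInormal : I.Normal)
    (hIlam : ∀ b : B, ∀ x ∈ I, b * x - b ∈ I)
    (hItriv : ∀ x ∈ I, ∀ y ∈ I, x * y = x + y)
    (π : B → H)
    (hπadd : ∀ a b : B, π (a + b) = π a + π b)
    (hπmul : ∀ a b : B, π (a * b) = π a * π b)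
    (hπsurj : Function.Surjective π)
    (hπker : ∀ b : B, π b = 0 ↔ b ∈ I)
    (s : H → B) (hs : ∀ h : H, π (s h) = h) (hs0 : s 0 = 0) :
    (∀ x : H, Set.BijOn (fun y : B => (s x)⁻¹ * y * s x) (I : Set B) (I : Set B)) ∧
    (∀ x : H, ∀ y₁ ∈ I, ∀ y₂ ∈ I,
      (s x)⁻¹ * (y₁ + y₂) * s x = (s x)⁻¹ * y₁ * s x + (s x)⁻¹ * y₂ * s x) ∧
    (∀ x₁ x₂ : H, ∀ y ∈ I,
      (s x₁)⁻¹ * ((s x₂)⁻¹ * y * s x₂) * s x₁ = (s (x₂ * x₁))⁻¹ * y * s (x₂ * x₁)) := by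
  have hconj : ∀ g : B, ∀ y ∈ I, g⁻¹ * y * g ∈ I := fun g y hy => by
    simpa using hInormal.conj_mem y hy g⁻¹
  refine ⟨fun x => ⟨fun y hy => hconj _ y hy, fun y _ z _ h => by simpa using h,
    fun z hz => ⟨s x * z * (s x)⁻¹, hInormal.conj_mem z hz _, by simp [mul_assoc]⟩⟩, ?_, ?_⟩
  · intro x y₁ h₁ y₂ h₂
    rw [← hItriv _ h₁ _ h₂, ← hItriv _ (hconj _ _ h₁) _ (hconj _ _ h₂)]
    group
  · intro x₁ x₂ y hy
    set k := s (x₂ * x₁) with hk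
    have hi : k⁻¹ * (s x₂ * s x₁) ∈ I := by
      rw [← hπker, hπmul, hπmul, hs, hs, ← hs (x₂ * x₁), ← hk, ← hπmul, inv_mul_cancel, hπker]
      exact I.one_mem
    have hcomm : k⁻¹ * y * k * (k⁻¹ * (s x₂ * s x₁)) =
        k⁻¹ * (s x₂ * s x₁) * (k⁻¹ * y * k) := by
      rw [hItriv _ (hconj k y hy) _ hi, hItriv _ hi _ (hconj k y hy), add_comm]
    calc (s x₁)⁻¹ * ((s x₂)⁻¹ * y * s x₂) * s x₁
        = (k⁻¹ * (s x₂ * s x₁))⁻¹ * (k⁻¹ * y * k * (k⁻¹ * (s x₂ * s x₁))) := by group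
      _ = k⁻¹ * y * k := by rw [hcomm, inv_mul_cancel_left]
end

section
/- Let B be a left brace, let I be an ideal of B whose induced brace structure is trivial, let H = B/I, and let s : H → B be a map with π∘s = id and s(0) = 0, where π : B → H is the natural projection. Then for all h₁,h₂ ∈ H the restrictions of the lambda maps to I satisfy λ_{s(h₁)} ∘ λ_{s(h₂)} = λ_{s(h₁·h₂)} as automorphisms of (I,+); consequently ν : (H,·) → Aut(I,+), ν_h := λ_{s(h)}|_I, is a well-defined group homomorphism (a left action), independent of the choice of section s. -/
namespace LeftBrace

section Basic

variable {B : Type*} [LeftBrace B]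

theorem mul_zero_eq (a : B) : a * (0 : B) = a := by
  have h := brace_law a 0 0
  rw [add_zero] at h
  exact (add_left_cancel h).symm

theorem one_eq_zero : (1 : B) = 0 := by
  rw [← mul_zero_eq (1 : B), one_mul]

theorem lambda_add (a b c : B) : a * (b + c) - a = (a * b - a) + (a * c - a) := by
  rw [eq_sub_of_add_eq (brace_law a b c)]
  abel

/-- The lambda map turns multiplication into composition. -/
theorem lambda_lambda (a b c : B) : a * (b * c - b) - a = a * b * c - a * b := by
  have h := brace_law a (b * c - b) b
  rw [sub_add_cancel, ← mul_assoc] at h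
  rw [sub_eq_sub_iff_add_eq_add, h]

theorem lambda_one (a : B) : 1 * a - 1 = a := by
  rw [one_mul, one_eq_zero, sub_zero]

theorem lambda_bijOn {I : Set B} (hI : ∀ b : B, ∀ x ∈ I, b * x - b ∈ I) (a : B) :
    Set.BijOn (fun y : B => a * y - a) I I := by
  refine ⟨fun x hx => hI a x hx, ?_, ?_⟩
  · intro x _ y _ hxy
    exact mul_left_cancel (sub_left_injective hxy)
  · intro y hy
    refine ⟨a⁻¹ * y - a⁻¹, hI _ y hy, ?_⟩
    change a * (a⁻¹ * y - a⁻¹) - a = y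
    rw [lambda_lambda, mul_inv_cancel, lambda_one]

end Basic

/-- If the kernel of a multiplicative map is a trivial brace, then the restriction of `λ_a` to
that kernel depends only on the image of `a`. -/
theorem lambda_eq_of_map_eq {B H : Type*} [LeftBrace B] [LeftBrace H] {I : Set B}
    (hI : ∀ x ∈ I, ∀ y ∈ I, x * y = x + y) {π : B → H}
    (hπmul : ∀ a b : B, π (a * b) = π a * π b) (hπker : ∀ b : B, π b = 0 ↔ b ∈ I)
    {a b : B} (hab : π a = π b) {y : B} (hy : y ∈ I) : a * y - a = b * y - b := by
  have hx : a⁻¹ * b ∈ I := by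
    rw [← hπker, ← one_eq_zero]
    have h := hπmul a (a⁻¹ * b)
    rw [mul_inv_cancel_left, ← hab] at h
    exact left_eq_mul.mp h
  have h := lambda_lambda a (a⁻¹ * b) y
  rwa [mul_inv_cancel_left, hI _ hx y hy, add_sub_cancel_left] at h

end LeftBrace

/-- Let `B` be a left brace, `I` an ideal of `B` with trivial induced brace structure,
`H = B/I` (presented by a surjective brace morphism `π : B → H` with kernel `I`), and
`s : H → B` a section with `π∘s = id`, `s(0) = 0`.  Then the restrictions to `I` of the
lambda maps satisfy `λ_{s(h₁)} ∘ λ_{s(h₂)} = λ_{s(h₁·h₂)}` as automorphisms of `(I,+)`;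
hence `ν_h := λ_{s(h)}|_I` is a well-defined group homomorphism (left action)
`(H,·) → Aut(I,+)`, independent of the choice of the section `s`. -/
theorem stmt6 (B H : Type*) [LeftBrace B] [LeftBrace H]
    (I : Subgroup B) (hInormal : I.Normal)
    (hIlam : ∀ b : B, ∀ x ∈ I, b * x - b ∈ I)
    (hItriv : ∀ x ∈ I, ∀ y ∈ I, x * y = x + y)
    (π : B → H)
    (hπadd : ∀ a b : B, π (a + b) = π a + π b)
    (hπmul : ∀ a b : B, π (a * b) = π a * π b)
    (hπsurj : Function.Surjective π)
    (hπker : ∀ b : B, π b = 0 ↔ b ∈ I)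
    (s : H → B) (hs : ∀ h : H, π (s h) = h) (hs0 : s 0 = 0) :
    (∀ h : H, Set.BijOn (fun y : B => s h * y - s h) (I : Set B) (I : Set B)) ∧
    (∀ h : H, ∀ y₁ ∈ I, ∀ y₂ ∈ I,
      s h * (y₁ + y₂) - s h = (s h * y₁ - s h) + (s h * y₂ - s h)) ∧
    (∀ h₁ h₂ : H, ∀ y ∈ I,
      s h₁ * (s h₂ * y - s h₂) - s h₁ = s (h₁ * h₂) * y - s (h₁ * h₂)) ∧
    (∀ s' : H → B, (∀ h : H, π (s' h) = h) →
      ∀ h : H, ∀ y ∈ I, s h * y - s h = s' h * y - s' h) := by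
  have key {a b : B} (hab : π a = π b) {y : B} (hy : y ∈ I) : a * y - a = b * y - b :=
    LeftBrace.lambda_eq_of_map_eq (I := (I : Set B)) hItriv hπmul hπker hab hy
  refine ⟨fun h => LeftBrace.lambda_bijOn hIlam (s h),
    fun h y₁ _ y₂ _ => LeftBrace.lambda_add (s h) y₁ y₂, fun h₁ h₂ y hy => ?_,
    fun s' hs' h y hy => key ((hs h).trans (hs' h).symm) hy⟩
  rw [LeftBrace.lambda_lambda]
  exact key (by rw [hπmul, hs, hs, hs]) hy
end

section
/- Let B be a left brace, let I be an ideal of B whose induced brace structure is trivial, let H = B/I, and let s : H → B be a map with π∘s = id and s(0) = 0. Define σ_x(y) := s(x)⁻¹·y·s(x), ν_h(y) := λ_{s(h)}(y), τ(h₁,h₂) := s(h₁·h₂)⁻¹·s(h₁)·s(h₂), and β(h₁,h₂) := s(h₁)+s(h₂)−s(h₁+h₂). Then for all h₁,h₂,h₃ ∈ H and y ∈ I the following two compatibility identities hold: (i) ν_{h₁+h₂}(σ_{h₁+h₂}(y)) + y = ν_{h₁}(σ_{h₁}(y)) + ν_{h₂}(σ_{h₂}(y)); (ii) ν_{h₁(h₂+h₃)}(τ(h₁,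 h₂+h₃)) + β(h₁(h₂+h₃), h₁) + ν_{h₁}(β(h₂,h₃)) = ν_{h₁h₂}(τ(h₁,h₂)) + ν_{h₁h₃}(τ(h₁,h₃)) + β(h₁h₂, h₁h₃). -/
/-- `ν_h(y) := λ_{s(h)}(y) = s(h)·y − s(h)`. -/
def nuMap {B H : Type*} [LeftBrace B] (s : H → B) (h : H) (y : B) : B := s h * y - s h

/-- `σ_x(y) := s(x)⁻¹·y·s(x)`. -/
def sigMap {B H : Type*} [LeftBrace B] (s : H → B) (x : H) (y : B) : B := (s x)⁻¹ * y * s x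

/-- `τ(h₁,h₂) := s(h₁·h₂)⁻¹·s(h₁)·s(h₂)`. -/
def tauMap {B H : Type*} [LeftBrace B] [LeftBrace H] (s : H → B) (h₁ h₂ : H) : B :=
  (s (h₁ * h₂))⁻¹ * s h₁ * s h₂

/-- `β(h₁,h₂) := s(h₁)+s(h₂)−s(h₁+h₂)`. -/
def betaMap {B H : Type*} [LeftBrace B] [LeftBrace H] (s : H → B) (h₁ h₂ : H) : B :=
  s h₁ + s h₂ - s (h₁ + h₂)

/-- Let `B` be a left brace, `I` an ideal of `B` with trivial induced brace structure,
`H = B/I` (presented by a surjective brace morphism `π : B → H` with kernel `I`), and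
`s : H → B` a section with `π∘s = id`, `s(0) = 0`.  Then the two compatibility
identities between `ν`, `σ`, `τ` and `β` hold:
(i) `ν_{h₁+h₂}(σ_{h₁+h₂}(y)) + y = ν_{h₁}(σ_{h₁}(y)) + ν_{h₂}(σ_{h₂}(y))` for `y ∈ I`;
(ii) `ν_{h₁(h₂+h₃)}(τ(h₁,h₂+h₃)) + β(h₁(h₂+h₃),h₁) + ν_{h₁}(β(h₂,h₃))
      = ν_{h₁h₂}(τ(h₁,h₂)) + ν_{h₁h₃}(τ(h₁,h₃)) + β(h₁h₂,h₁h₃)`. -/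
theorem stmt9 (B H : Type*) [LeftBrace B] [LeftBrace H]
    (I : Subgroup B) (hInormal : I.Normal)
    (hIlam : ∀ b : B, ∀ x ∈ I, b * x - b ∈ I)
    (hItriv : ∀ x ∈ I, ∀ y ∈ I, x * y = x + y)
    (π : B → H)
    (hπadd : ∀ a b : B, π (a + b) = π a + π b)
    (hπmul : ∀ a b : B, π (a * b) = π a * π b)
    (hπsurj : Function.Surjective π)
    (hπker : ∀ b : B, π b = 0 ↔ b ∈ I)
    (s : H → B) (hs : ∀ h : H, π (s h) = h) (hs0 : s 0 = 0) :
    (∀ h₁ h₂ : H, ∀ y ∈ I,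
      nuMap s (h₁ + h₂) (sigMap s (h₁ + h₂) y) + y
        = nuMap s h₁ (sigMap s h₁ y) + nuMap s h₂ (sigMap s h₂ y)) ∧
    (∀ h₁ h₂ h₃ : H,
      nuMap s (h₁ * (h₂ + h₃)) (tauMap s h₁ (h₂ + h₃))
          + betaMap s (h₁ * (h₂ + h₃)) h₁ + nuMap s h₁ (betaMap s h₂ h₃)
        = nuMap s (h₁ * h₂) (tauMap s h₁ h₂) + nuMap s (h₁ * h₃) (tauMap s h₁ h₃)
          + betaMap s (h₁ * h₂) (h₁ * h₃)) := by
  have nu_sig : ∀ h y, nuMap s h (sigMap s h y) = y * s h - s h := fun h y => by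
    simp [nuMap, sigMap, ← mul_assoc]
  have nu_tau : ∀ h₁ h₂ : H,
      nuMap s (h₁ * h₂) (tauMap s h₁ h₂) = s h₁ * s h₂ - s (h₁ * h₂) := fun h₁ h₂ => by
    simp [nuMap, tauMap, ← mul_assoc]
  have beta_mem : ∀ h₁ h₂ : H, betaMap s h₁ h₂ ∈ I := fun h₁ h₂ => by
    rw [← hπker]
    have h := hπadd (betaMap s h₁ h₂) (s (h₁ + h₂))
    rw [betaMap, sub_add_cancel, hπadd, hs, hs, hs] at h
    exact right_eq_add.mp h
  have add_eq : ∀ h₁ h₂ : H, s h₁ + s h₂ = betaMap s h₁ h₂ + s (h₁ + h₂) :=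
    fun h₁ h₂ => (sub_add_cancel _ _).symm
  refine ⟨fun h₁ h₂ y hy => ?_, fun h₁ h₂ h₃ => ?_⟩
  · have e₁ := LeftBrace.brace_law y (s h₁) (s h₂)
    have e₂ := LeftBrace.brace_law y (betaMap s h₁ h₂) (s (h₁ + h₂))
    rw [hItriv y hy _ (beta_mem h₁ h₂), ← add_eq, e₁] at e₂
    rw [nu_sig, nu_sig, nu_sig, sub_add_sub_comm, e₂, add_eq]
    abel
  · have e₁ := LeftBrace.brace_law (s h₁) (s h₂) (s h₃)
    have e₂ := LeftBrace.brace_law (s h₁) (betaMap s h₂ h₃) (s (h₂ + h₃))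
    rw [← add_eq, e₁] at e₂
    have beta_mul : ∀ a b c : H, betaMap s (a * b) c = s (a * b) + s c - s (a * b + c) :=
      fun _ _ _ => rfl
    rw [nu_tau, nu_tau, nu_tau, beta_mul, LeftBrace.brace_law h₁ h₂ h₃, beta_mul, nuMap,
      sub_add_sub_comm (s h₁ * s h₂), e₂]
    abel
end

section
/- Let B be a finite left brace and n a positive integer. Then the subset nB = { n·a : a ∈ B } (where n·a denotes the n-fold additive multiple of a) is a left ideal of B; in particular, nB is a subgroup of the multiplicative group (B,·), closed under the product a·a' = a + λ_a(a'). -/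
/-- The subset `nB = {n·a : a ∈ B}` of a left brace `B`. -/
def nMultiples (B : Type*) [LeftBrace B] (n : ℕ) : Set B := {x : B | ∃ a : B, x = n • a}

namespace LeftBrace

variable {B : Type*} [LeftBrace B]

/-- The lambda map `λ_a(b) = a·b − a`, as an endomorphism of the additive group. -/
def lambda (a : B) : B →+ B :=
  AddMonoidHom.mk' (fun b => a * b - a) fun b c => by
    rw [eq_sub_of_add_eq (brace_law a b c)]
    abel

theorem lambda_apply (a b : B) : lambda a b = a * b - a := rfl

theorem mul_eq_add_lambda (a b : B) : a * b = a + lambda a b := by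
  rw [lambda_apply, add_sub_cancel]

theorem inv_eq_neg_lambda (a : B) : a⁻¹ = -lambda a⁻¹ a := by
  rw [lambda_apply, inv_mul_cancel, one_eq_zero, zero_sub, neg_neg]

theorem lambda_mem_nMultiples (b : B) {n : ℕ} {x : B} (hx : x ∈ nMultiples B n) :
    lambda b x ∈ nMultiples B n := by
  obtain ⟨a, rfl⟩ := hx
  exact ⟨lambda b a, map_nsmul _ _ _⟩

end LeftBrace

/-- Let `B` be a finite left brace and `n` a positive integer.  Then
`nB = {n·a : a ∈ B}` is a left ideal of `B`: it is a subgroup of `(B,·)` closed under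
all lambda maps `λ_b(x) = b·x − b`; in particular it is closed under the product. -/
theorem stmt16 (B : Type*) [LeftBrace B] [Finite B] (n : ℕ) (hn : 0 < n) :
    ((1 : B) ∈ nMultiples B n) ∧
    (∀ x ∈ nMultiples B n, ∀ y ∈ nMultiples B n, x * y ∈ nMultiples B n) ∧
    (∀ x ∈ nMultiples B n, x⁻¹ ∈ nMultiples B n) ∧
    (∀ b : B, ∀ x ∈ nMultiples B n, b * x - b ∈ nMultiples B n) := by
  refine ⟨⟨0, by rw [LeftBrace.one_eq_zero, nsmul_zero]⟩, ?_, ?_,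
    fun b _ hx => LeftBrace.lambda_mem_nMultiples b hx⟩
  · rintro x ⟨a, ha⟩ y hy
    obtain ⟨c, hc⟩ := LeftBrace.lambda_mem_nMultiples x hy
    exact ⟨a + c, by rw [LeftBrace.mul_eq_add_lambda, hc, nsmul_add, ← ha]⟩
  · intro x hx
    obtain ⟨c, hc⟩ := LeftBrace.lambda_mem_nMultiples x⁻¹ hx
    exact ⟨-c, by rw [LeftBrace.inv_eq_neg_lambda, hc, neg_nsmul]⟩
end

section
/- Let B be a finite left brace and let H be a Hall subgroup of the multiplicative group (B,·), i.e. gcd(|H|, [B:H]) = 1. If H is a normal subgroup of (B,·), then H is an ideal of the left brace B; in particular H is closed under addition and under all lambda maps λ_b for b ∈ B. -/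
namespace LeftBrace

variable {B : Type*} [LeftBrace B]

/-- The map `λ_a : b ↦ a·b − a`, as an endomorphism of `(B,+)`. -/
def lambdaHom (a : B) : B →+ B :=
  AddMonoidHom.mk' (fun b => a * b - a) fun b c => by
    have h := brace_law a b c
    rw [← eq_sub_iff_add_eq] at h
    rw [h]
    abel

theorem lambdaHom_apply (a b : B) : lambdaHom a b = a * b - a := rfl

theorem nsmul_lambdaHom_eq_zero {n : ℕ} {b : B} (a : B) (hb : n • b = 0) :
    n • (a * b - a) = 0 := by
  rw [← lambdaHom_apply, ← map_nsmul, hb, map_zero]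

/-- The additive `n`-torsion of a left brace, as a subgroup of `(B,·)`. -/
def torsionSubgroup (B : Type*) [LeftBrace B] (n : ℕ) : Subgroup B where
  carrier := {x | n • x = 0}
  one_mem' := by
    change n • (1 : B) = 0
    rw [one_eq_zero, nsmul_zero]
  mul_mem' {a b} ha hb := by
    change n • (a * b) = 0
    rw [← sub_add_cancel (a * b) a, nsmul_add, nsmul_lambdaHom_eq_zero a hb, zero_add]
    exact ha
  inv_mem' {a} ha := by
    change n • a⁻¹ = 0
    have h := nsmul_lambdaHom_eq_zero a⁻¹ ha
    rwa [inv_mul_cancel, one_eq_zero, zero_sub, smul_neg, neg_eq_zero] at h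

theorem mem_torsionSubgroup {n : ℕ} {x : B} : x ∈ torsionSubgroup B n ↔ n • x = 0 := Iff.rfl

end LeftBrace

/-- The order of a finite additive group killed by `n` is coprime to every number coprime to `n`. -/
theorem AddGroup.card_coprime_of_nsmul_eq_zero {A : Type*} [AddGroup A] [Finite A] {n m : ℕ}
    (hA : ∀ x : A, n • x = 0) (hnm : n.Coprime m) : (Nat.card A).Coprime m := by
  refine Nat.coprime_of_dvd fun p hp hpA hpm => ?_
  have := Fact.mk hp
  obtain ⟨y, hy⟩ := exists_prime_addOrderOf_dvd_card' p hpA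
  have hpn : p ∣ n := hy ▸ addOrderOf_dvd_of_nsmul_eq_zero (hA y)
  exact Nat.not_coprime_of_dvd_of_dvd hp.one_lt hpn hpm hnm

/-- In a finite abelian group of order `n * m` with `n` and `m` coprime, the `n`-torsion has
order at least `n`. -/
theorem AddCommGroup.le_card_ker_nsmul {A : Type*} [AddCommGroup A] [Finite A] {n m : ℕ}
    (hcard : Nat.card A = n * m) (hnm : n.Coprime m) :
    n ≤ Nat.card (nsmulAddMonoidHom (α := A) n).ker := by
  set f := nsmulAddMonoidHom (α := A) n
  have hmul : Nat.card f.ker * Nat.card f.range = n * m := by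
    rw [← AddSubgroup.index_ker, AddSubgroup.card_mul_index, hcard]
  have hcop : n.Coprime (Nat.card f.range) := by
    refine (AddGroup.card_coprime_of_nsmul_eq_zero ?_ hnm.symm).symm
    rintro ⟨_, y, rfl⟩
    refine Subtype.ext ?_
    change m • n • y = 0
    rw [smul_smul, mul_comm, ← hcard, card_nsmul_eq_zero']
  exact Nat.le_of_dvd Nat.card_pos (hcop.dvd_of_dvd_mul_right ⟨m, hmul⟩)

/-- A subgroup whose order is at least that of a normal Hall subgroup `H` and which has order
coprime to the index of `H` is equal to `H`. -/
theorem Subgroup.eq_of_card_le_of_coprime_index {G : Type*} [Group G] [Finite G]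
    {H K : Subgroup G} [H.Normal] (hle : Nat.card H ≤ Nat.card K)
    (hK : (Nat.card K).Coprime H.index) : K = H := by
  refine Subgroup.eq_of_le_of_card_ge (fun x hx => ?_) hle
  have h1 : x ^ Nat.card K = 1 :=
    congrArg Subtype.val (pow_card_eq_one' (x := (⟨x, hx⟩ : K)))
  have h2 : (x : G ⧸ H) ^ Nat.card K = 1 := by
    rw [← QuotientGroup.mk_pow, h1, QuotientGroup.mk_one]
  have h3 : (x : G ⧸ H) ^ H.index = 1 := pow_card_eq_one'
  have h4 := pow_gcd_eq_one.mpr ⟨h2, h3⟩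
  rwa [hK, pow_one, QuotientGroup.eq_one_iff] at h4

/-- A normal Hall subgroup of `(B,·)` is the additive torsion of the same order. -/
theorem LeftBrace.torsionSubgroup_card_eq {B : Type*} [LeftBrace B] [Finite B] (H : Subgroup B)
    [H.Normal] (hHall : (Nat.card H).Coprime H.index) :
    torsionSubgroup B (Nat.card H) = H := by
  refine Subgroup.eq_of_card_le_of_coprime_index
    (AddCommGroup.le_card_ker_nsmul (A := B) H.card_mul_index.symm hHall) ?_
  exact AddGroup.card_coprime_of_nsmul_eq_zero
    (A := (nsmulAddMonoidHom (α := B) (Nat.card H)).ker) (fun x => Subtype.ext x.2) hHall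

/-- Let `B` be a finite left brace and `H` a Hall subgroup of `(B,·)` (i.e.
`gcd(|H|,[B:H]) = 1`).  If `H` is normal in `(B,·)`, then `H` is an ideal of the left
brace `B`; in particular `H` is closed under all lambda maps `λ_b(x) = b·x − b` and
under addition. -/
theorem stmt17 (B : Type*) [LeftBrace B] [Finite B]
    (H : Subgroup B) (hnormal : H.Normal)
    (hHall : Nat.Coprime (Nat.card H) H.index) :
    (∀ b : B, ∀ x ∈ H, b * x - b ∈ H) ∧
    (∀ x ∈ H, ∀ y ∈ H, x + y ∈ H) := by
  have hmem : ∀ x : B, x ∈ H ↔ Nat.card H • x = 0 := fun x => by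
    rw [← LeftBrace.mem_torsionSubgroup, LeftBrace.torsionSubgroup_card_eq H hHall]
  refine ⟨fun b x hx => ?_, fun x hx y hy => ?_⟩
  · rw [hmem] at hx ⊢
    exact LeftBrace.nsmul_lambdaHom_eq_zero b hx
  · rw [hmem] at hx hy ⊢
    rw [nsmul_add, hx, hy, add_zero]
end

section
/- Let p₁ and p₂ be prime numbers such that p₂ divides p₁ − 1, and let k be a positive integer. Then there exists a simple left brace whose additive group is isomorphic to ℤ/(p₁) × (ℤ/(p₂))^{k(p₁−1)+1}; in particular, for every such pair of primes there exists a non-trivial simple left brace of order p₁ · p₂^{k(p₁−1)+1} (for k = 1, of order p₁ · p₂^{p₁}). -/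
/-- `mul` makes the abelian group `A` into a left brace: `(A, mul)` is a group (whose
neutral element is necessarily `0`) and the left brace law holds. -/
def IsBraceMul {A : Type*} [AddCommGroup A] (mul : A → A → A) : Prop :=
  (∀ a b c : A, mul (mul a b) c = mul a (mul b c)) ∧
  (∀ a : A, mul a 0 = a ∧ mul 0 a = a) ∧
  (∀ a : A, ∃ b : A, mul a b = 0 ∧ mul b a = 0) ∧
  (∀ a b c : A, mul a (b + c) + a = mul a b + mul a c)

/-- `I` is an ideal of the left brace `(A, +, mul)`: a normal subgroup of `(A, mul)`
closed under all lambda maps `λ_g(x) = mul g x − g`. -/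
def IsIdealOf {A : Type*} [AddCommGroup A] (mul : A → A → A) (I : Set A) : Prop :=
  (0 ∈ I) ∧
  (∀ x ∈ I, ∀ y ∈ I, mul x y ∈ I) ∧
  (∀ x ∈ I, ∃ y ∈ I, mul x y = 0 ∧ mul y x = 0) ∧
  (∀ g h x : A, x ∈ I → mul g x = mul h g → h ∈ I) ∧
  (∀ g : A, ∀ x ∈ I, mul g x - g ∈ I)

/-- The left brace `(A, +, mul)` is simple: it is non-zero and its only ideals are
`{0}` and `A`. -/
def IsSimpleBraceMul {A : Type*} [AddCommGroup A] (mul : A → A → A) : Prop :=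
  Nontrivial A ∧ ∀ I : Set A, IsIdealOf mul I → I = {0} ∨ I = Set.univ

section Ideals

variable {A : Type*} [AddCommGroup A] {mul : A → A → A}

theorem IsBraceMul.mul_sub (hB : IsBraceMul mul) (a b c : A) :
    mul a (b - c) = mul a b - mul a c + a := by
  have h := hB.2.2.2 a (b - c) c
  rw [sub_add_cancel] at h
  rw [sub_add_eq_add_sub, h, add_sub_cancel_right]

/-- An ideal of a left brace is a subgroup of the additive group. -/
def IsIdealOf.toAddSubgroup {I : Set A} (hI : IsIdealOf mul I) (hB : IsBraceMul mul) :
    AddSubgroup A where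
  carrier := I
  zero_mem' := hI.1
  add_mem' := by
    intro x y hx hy
    obtain ⟨x', -, hx', -⟩ := hI.2.2.1 x hx
    have h := hI.2.1 x hx _ (hI.2.2.2.2 x' y hy)
    rwa [hB.mul_sub, ← hB.1, hx', (hB.2.1 y).2, sub_zero, add_comm] at h
  neg_mem' := by
    intro x hx
    obtain ⟨x', hx'I, hx', -⟩ := hI.2.2.1 x hx
    have h := hI.2.2.2.2 x x' hx'I
    rwa [hx', zero_sub] at h

theorem IsIdealOf.mem_toAddSubgroup {I : Set A} (hI : IsIdealOf mul I) (hB : IsBraceMul mul)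
    {x : A} : x ∈ hI.toAddSubgroup hB ↔ x ∈ I := Iff.rfl

end Ideals

section Transport

variable {A A' : Type*} [AddCommGroup A] [AddCommGroup A'] {mul : A → A → A}

theorem IsBraceMul.transport (hB : IsBraceMul mul) (e : A ≃+ A') :
    IsBraceMul fun a b => e (mul (e.symm a) (e.symm b)) := by
  refine ⟨fun a b c => ?_, fun a => ?_, fun a => ?_, fun a b c => ?_⟩
  · simp [hB.1]
  · simp [hB.2.1]
  · obtain ⟨b, h1, h2⟩ := hB.2.2.1 (e.symm a)
    exact ⟨e b, by simp [h1], by simp [h2]⟩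
  · have h := congrArg e (hB.2.2.2 (e.symm a) (e.symm b) (e.symm c))
    simpa using h

theorem IsSimpleBraceMul.transport (hS : IsSimpleBraceMul mul) (e : A ≃+ A') :
    IsSimpleBraceMul fun a b => e (mul (e.symm a) (e.symm b)) := by
  have := hS.1
  refine ⟨e.injective.nontrivial, fun I hI => ?_⟩
  have hJ : IsIdealOf mul (e ⁻¹' I) := by
    obtain ⟨h0, h1, h2, h3, h4⟩ := hI
    refine ⟨by simpa using h0, fun x hx y hy => ?_, fun x hx => ?_, fun g h x hx hg => ?_,
      fun g x hx => ?_⟩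
    · simpa using h1 _ hx _ hy
    · obtain ⟨y, hy, hxy, hyx⟩ := h2 _ hx
      exact ⟨e.symm y, by simpa using hy, by simpa using hxy, by simpa using hyx⟩
    · exact h3 (e g) (e h) (e x) hx (by simp [hg])
    · simpa using h4 (e g) (e x) hx
  have hI' : I = e.symm ⁻¹' (e ⁻¹' I) := by ext; simp
  rcases hS.2 _ hJ with h | h
  · left
    rw [hI', h]
    ext x
    simp
  · right
    rw [hI', h]
    rfl

end Transport

/-- An orthogonal representation `act` on `(V, Q)` of the group `ℤ/(p) ⋊ ℤ/(q)`, in which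
`z ∈ ℤ/(q)` acts on `ℤ/(p)` as multiplication by `χ z`. -/
structure OrthogonalAction (p q : ℕ) (V : Type*) [AddCommGroup V] where
  /-- the action of `ℤ/(q)` on `ℤ/(p)` -/
  χ : ZMod q → ZMod p
  χ_zero : χ 0 = 1
  χ_add : ∀ z z', χ (z + z') = χ z * χ z'
  /-- the action of `(c, z)` on `V` -/
  act : ZMod p → ZMod q → V →+ V
  act_zero : ∀ t, act 0 0 t = t
  act_act : ∀ c z c' z' t, act c z (act c' z' t) = act (c + χ z * c') (z + z') t
  /-- the invariant quadratic form -/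
  Q : V → ZMod q
  /-- the polar form of `Q` -/
  b : V →+ V →+ ZMod q
  Q_add : ∀ t t', Q (t + t') = Q t + Q t' + b t t'
  Q_act : ∀ c z t, Q (act c z t) = Q t

namespace OrthogonalAction

variable {p q : ℕ} {V : Type*} [AddCommGroup V] (D : OrthogonalAction p q V)

theorem b_act (c : ZMod p) (z : ZMod q) (t t' : V) :
    D.b (D.act c z t) (D.act c z t') = D.b t t' := by
  have h := D.Q_add (D.act c z t) (D.act c z t')
  rw [← map_add, D.Q_act, D.Q_act, D.Q_act, D.Q_add] at h
  exact (add_left_cancel h).symm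

theorem Q_zero : D.Q 0 = 0 := by
  have h := D.Q_add 0 0
  simpa using h

/-- The projection of `ℤ/(p) × V × ℤ/(q)` onto the acting group `ℤ/(q)`. -/
def height (x : ZMod p × V × ZMod q) : ZMod q := x.2.2 + D.Q x.2.1

/-- The asymmetric product of `V` by `ℤ/(p) ⋊ ℤ/(q)` along the polar form of `Q`, in
coordinates where the addition is componentwise. -/
def mul (x y : ZMod p × V × ZMod q) : ZMod p × V × ZMod q :=
  (x.1 + D.χ (D.height x) * y.1,
    x.2.1 + D.act x.1 (D.height x) y.2.1,
    x.2.2 + y.2.2 - D.b x.2.1 (D.act x.1 (D.height x) y.2.1))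

theorem height_mul (x y : ZMod p × V × ZMod q) :
    D.height (D.mul x y) = D.height x + D.height y := by
  simp only [height, mul, D.Q_add, D.Q_act]
  ring

theorem mul_assoc (x y z : ZMod p × V × ZMod q) :
    D.mul (D.mul x y) z = D.mul x (D.mul y z) := by
  have h := D.height_mul x y
  refine Prod.ext ?_ (Prod.ext ?_ ?_)
  · change (D.mul x y).1 + D.χ (D.height (D.mul x y)) * z.1 = _
    rw [h, D.χ_add]
    simp only [mul]
    ring
  · change (D.mul x y).2.1 + D.act (D.mul x y).1 (D.height (D.mul x y)) z.2.1 = _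
    rw [h]
    simp only [mul, map_add, D.act_act, add_assoc]
  · change (D.mul x y).2.2 + z.2.2 -
      D.b (D.mul x y).2.1 (D.act (D.mul x y).1 (D.height (D.mul x y)) z.2.1) = _
    rw [h]
    simp only [mul, ← D.act_act, map_add, AddMonoidHom.add_apply, D.b_act]
    ring

theorem mul_zero (x : ZMod p × V × ZMod q) : D.mul x 0 = x := by
  simp [mul]

theorem zero_mul (x : ZMod p × V × ZMod q) : D.mul 0 x = x := by
  simp [mul, height, D.Q_zero, D.χ_zero, D.act_zero]

theorem exists_mul_eq_zero (x : ZMod p × V × ZMod q) : ∃ y, D.mul x y = 0 := by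
  have hχ : D.χ (D.height x) * D.χ (-D.height x) = 1 := by
    rw [← D.χ_add, add_neg_cancel, D.χ_zero]
  have hc : x.1 + D.χ (D.height x) * (-(D.χ (-D.height x) * x.1)) = 0 := by
    linear_combination (-x.1) * hχ
  have ha : D.act x.1 (D.height x)
      (D.act (-(D.χ (-D.height x) * x.1)) (-D.height x) (-x.2.1)) = -x.2.1 := by
    rw [D.act_act, hc, add_neg_cancel, D.act_zero]
  refine ⟨(-(D.χ (-D.height x) * x.1),
    D.act (-(D.χ (-D.height x) * x.1)) (-D.height x) (-x.2.1), -x.2.2 - D.b x.2.1 x.2.1), ?_⟩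
  refine Prod.ext hc (Prod.ext ?_ ?_)
  · simp only [mul, ha, add_neg_cancel, Prod.snd_zero, Prod.fst_zero]
  · simp only [mul, ha, Prod.snd_zero]
    rw [map_neg]
    ring

theorem isBraceMul : IsBraceMul D.mul := by
  refine ⟨D.mul_assoc, fun a => ⟨D.mul_zero a, D.zero_mul a⟩, fun a => ?_, fun a b c => ?_⟩
  · obtain ⟨a', h⟩ := D.exists_mul_eq_zero a
    obtain ⟨a'', h'⟩ := D.exists_mul_eq_zero a'
    have : a'' = a := by
      rw [← D.zero_mul a'', ← h, D.mul_assoc, h', D.mul_zero]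
    exact ⟨a', h, this ▸ h'⟩
  · refine Prod.ext ?_ (Prod.ext ?_ ?_)
    · simp only [mul, Prod.fst_add]
      ring
    · simp only [mul, Prod.snd_add, Prod.fst_add, map_add]
      abel
    · simp only [mul, Prod.snd_add, Prod.fst_add, map_add]
      ring

section Simple

variable [Fact p.Prime] [Fact q.Prime] {I : Set (ZMod p × V × ZMod q)}

theorem form_mem (hI : IsIdealOf D.mul I) {c : ZMod p} {t : V} {w : ZMod q}
    (hx : (c, t, w) ∈ I) (s : V) :
    ((0, 0, D.b s t) : ZMod p × V × ZMod q) ∈ I := by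
  have h := hI.2.2.2.2 (0, s, -D.Q s) _ hx
  have h' := (hI.toAddSubgroup D.isBraceMul).sub_mem hx h
  convert (hI.mem_toAddSubgroup D.isBraceMul).1 h' using 1
  simp only [mul, height, neg_add_cancel, D.χ_zero, D.act_zero]
  ext <;> simp
  ring

theorem third_mem (hI : IsIdealOf D.mul I) {u : ZMod q} (hu : u ≠ 0)
    (hx : ((0, 0, u) : ZMod p × V × ZMod q) ∈ I)
    (w : ZMod q) : ((0, 0, w) : ZMod p × V × ZMod q) ∈ I := by
  have h := (hI.toAddSubgroup D.isBraceMul).nsmul_mem hx (w * u⁻¹).val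
  convert (hI.mem_toAddSubgroup D.isBraceMul).1 h using 1
  simp [hu]

theorem first_mem (hI : IsIdealOf D.mul I) (hχ : D.χ 1 ≠ 1)
    (hx : ((0, 0, 1) : ZMod p × V × ZMod q) ∈ I)
    (c : ZMod p) : ((c, 0, 0) : ZMod p × V × ZMod q) ∈ I := by
  have hχ' : 1 - D.χ 1 ≠ 0 := sub_ne_zero.2 hχ.symm
  have h : ((c, 0, 1) : ZMod p × V × ZMod q) ∈ I := by
    refine hI.2.2.2.1 (c / (1 - D.χ 1), 0, 0) _ _ hx ?_
    have hc : c / (1 - D.χ 1) = c + D.χ 1 * (c / (1 - D.χ 1)) := by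
      field_simp
      ring
    simpa [mul, height, D.Q_zero] using hc
  convert (hI.mem_toAddSubgroup D.isBraceMul).1
    ((hI.toAddSubgroup D.isBraceMul).sub_mem h hx) using 1
  simp

theorem sub_act_mem (hI : IsIdealOf D.mul I) {c : ZMod p}
    (hx : ((c, 0, 0) : ZMod p × V × ZMod q) ∈ I) (t : V) :
    ((0, t - D.act c 0 t, -D.Q (t - D.act c 0 t)) : ZMod p × V × ZMod q) ∈ I := by
  have h : ((c, t - D.act c 0 t, -D.Q (t - D.act c 0 t)) : ZMod p × V × ZMod q) ∈ I := by
    refine hI.2.2.2.1 (0, t, -D.Q t) _ _ hx ?_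
    have hQ := D.Q_add (t - D.act c 0 t) (D.act c 0 t)
    rw [sub_add_cancel, D.Q_act] at hQ
    refine Prod.ext ?_ (Prod.ext ?_ ?_)
    · simp [mul, height, D.χ_zero]
    · simp [mul, height]
    · simp only [mul, height, neg_add_cancel, map_zero]
      linear_combination -hQ
  have h' := (hI.toAddSubgroup D.isBraceMul).sub_mem h hx
  simpa [hI.mem_toAddSubgroup D.isBraceMul] using h'

theorem χ_sub_mem (hI : IsIdealOf D.mul I) {c : ZMod p} {w : ZMod q}
    (hx : ((c, 0, w) : ZMod p × V × ZMod q) ∈ I) :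
    (((D.χ 1 - 1) * c, 0, 0) : ZMod p × V × ZMod q) ∈ I := by
  have h := hI.2.2.2.2 (0, 0, 1) _ hx
  have h' := (hI.toAddSubgroup D.isBraceMul).sub_mem h hx
  convert (hI.mem_toAddSubgroup D.isBraceMul).1 h' using 1
  simp [mul, height, D.Q_zero, sub_one_mul]

/-- The asymmetric product is simple when the form is non-degenerate, `ℤ/(p)` acts faithfully on
`V` with no non-zero coinvariants, and `ℤ/(q)` acts non-trivially on `ℤ/(p)`. -/
theorem isSimpleBraceMul (hχ : D.χ 1 ≠ 1) (hb : ∀ t, t ≠ 0 → ∃ s, D.b s t ≠ 0)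
    (hf : ∀ c, c ≠ 0 → ∃ t, D.act c 0 t ≠ t)
    (hco : ∀ J : AddSubgroup V, (∀ c t, t - D.act c 0 t ∈ J) → J = ⊤) :
    IsSimpleBraceMul D.mul := by
  refine ⟨inferInstance, fun I hI => ?_⟩
  by_cases h0 : ∀ x ∈ I, x = 0
  · left
    exact Set.eq_singleton_iff_unique_mem.2 ⟨hI.1, h0⟩
  right
  push Not at h0
  obtain ⟨⟨c, t, w⟩, hx, hne⟩ := h0
  have key : ∀ {c : ZMod p} {t : V} {w : ZMod q}, (c, t, w) ∈ I → t ≠ 0 →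
      ∃ u : ZMod q, u ≠ 0 ∧ ((0, 0, u) : ZMod p × V × ZMod q) ∈ I := by
    intro c t w hx ht
    obtain ⟨s, hs⟩ := hb t ht
    exact ⟨_, hs, D.form_mem hI hx s⟩
  have hu : ∃ u : ZMod q, u ≠ 0 ∧ ((0, 0, u) : ZMod p × V × ZMod q) ∈ I := by
    by_cases ht : t = 0
    · subst ht
      by_cases hc : c = 0
      · subst hc
        exact ⟨w, fun hw => hne (by simp [hw]), hx⟩
      · obtain ⟨t, ht⟩ := hf _ (mul_ne_zero (sub_ne_zero.2 hχ) hc)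
        exact key (D.sub_act_mem hI (D.χ_sub_mem hI hx) t) (sub_ne_zero.2 ht.symm)
    · exact key hx ht
  obtain ⟨u, hu, hxu⟩ := hu
  have h3 := D.third_mem hI hu hxu
  have h1 := D.first_mem hI hχ (h3 1)
  have h2 : ∀ t : V, ((0, t, 0) : ZMod p × V × ZMod q) ∈ I := by
    let φ : V →+ ZMod p × V × ZMod q :=
      (AddMonoidHom.inr (ZMod p) (V × ZMod q)).comp (AddMonoidHom.inl V (ZMod q))
    have hJ := hco ((hI.toAddSubgroup D.isBraceMul).comap φ) fun c t => by
      have h := (hI.toAddSubgroup D.isBraceMul).add_mem (D.sub_act_mem hI (h1 c) t)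
        (h3 (D.Q (t - D.act c 0 t)))
      simpa [φ] using h
    intro t
    have : t ∈ (hI.toAddSubgroup D.isBraceMul).comap φ := hJ ▸ AddSubgroup.mem_top t
    exact this
  refine Set.eq_univ_of_forall fun ⟨c, t, w⟩ => ?_
  have h := (hI.toAddSubgroup D.isBraceMul).add_mem (h1 c)
    ((hI.toAddSubgroup D.isBraceMul).add_mem (h2 t) (h3 w))
  simpa [hI.mem_toAddSubgroup D.isBraceMul] using h

end Simple

end OrthogonalAction

section SecondSymmetric

variable {ι R : Type*} [CommRing R]

/-- The second elementary symmetric function of the values of `f` on `s`. -/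
def esymmTwo (s : Finset ι) (f : ι → R) : R := (s.val.map f).esymm 2

theorem esymmTwo_cons {s : Finset ι} {a : ι} (ha : a ∉ s) (f : ι → R) :
    esymmTwo (s.cons a ha) f = esymmTwo s f + f a * ∑ i ∈ s, f i := by
  simp [esymmTwo, Multiset.esymm, Multiset.powersetCard_cons, Multiset.powersetCard_one,
    Finset.mul_sum]

theorem esymmTwo_add (s : Finset ι) (f g : ι → R) :
    esymmTwo s (f + g) =
      esymmTwo s f + esymmTwo s g + ((∑ i ∈ s, f i) * (∑ i ∈ s, g i) - ∑ i ∈ s, f i * g i) := by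
  induction s using Finset.cons_induction with
  | empty => simp [esymmTwo, Multiset.esymm, Multiset.powersetCard_zero_right]
  | cons a s ha ih =>
    simp only [esymmTwo_cons, ih, Finset.sum_cons, Pi.add_apply, Finset.sum_add_distrib]
    ring

theorem esymmTwo_comp_equiv [Fintype ι] (σ : Equiv.Perm ι) (f : ι → R) :
    esymmTwo Finset.univ (f ∘ σ) = esymmTwo Finset.univ f := by
  have h : Finset.univ.val.map σ = (Finset.univ : Finset ι).val := by
    simp
  rw [esymmTwo, ← Multiset.map_map, h, esymmTwo]

end SecondSymmetric

section SumZero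

variable (p q k : ℕ) [Fact p.Prime] [Fact q.Prime]

/-- The `k`-th power of the augmentation module of `ℤ/(p)` over `ℤ/(q)`. -/
def sumZero : Submodule (ZMod q) (Fin k → ZMod p → ZMod q) where
  carrier := {f | ∀ i, ∑ x, f i x = 0}
  zero_mem' := by simp
  add_mem' := by
    intro f g hf hg i
    simp [Finset.sum_add_distrib, hf i, hg i]
  smul_mem' := by
    intro r f hf i
    simp [← Finset.mul_sum, hf i]

theorem finrank_sumZero : Module.finrank (ZMod q) (sumZero p q k) = k * (p - 1) := by
  let φ : (Fin k → ZMod p → ZMod q) →ₗ[ZMod q] (Fin k → ZMod q) :=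
    { toFun := fun f i => ∑ x, f i x
      map_add' := fun f g => by ext; simp [Finset.sum_add_distrib]
      map_smul' := fun r f => by ext; simp [Finset.mul_sum] }
  have hker : LinearMap.ker φ = sumZero p q k := by
    ext f
    simp [φ, sumZero, funext_iff]
  have hsurj : Function.Surjective φ := fun g =>
    ⟨fun i => Pi.single 0 (g i), by ext i; simp [φ]⟩
  have h := φ.finrank_range_add_finrank_ker
  rw [LinearMap.range_eq_top.2 hsurj, hker, finrank_top, Module.finrank_fin_fun,
    Module.finrank_pi_fintype] at h
  simp only [Module.finrank_fintype_fun_eq_card, Fintype.card_fin, ZMod.card, Finset.sum_const,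
    Finset.card_univ, smul_eq_mul] at h
  rw [Nat.mul_sub_one]
  omega

variable {p q k}

theorem natCast_ne_zero_of_prime_ne (hpq : p ≠ q) : (p : ZMod q) ≠ 0 := by
  rw [Ne, ZMod.natCast_eq_zero_iff, Nat.prime_dvd_prime_iff_eq Fact.out Fact.out]
  exact hpq.symm

theorem sumZero_eq_zero (hpq : p ≠ q) {f : Fin k → ZMod p → ZMod q} (hf : f ∈ sumZero p q k)
    (h : ∀ i x y, f i x = f i y) : f = 0 := by
  funext i x
  have h1 := hf i
  rw [Finset.sum_congr rfl fun y _ => h i y x] at h1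
  have hp := natCast_ne_zero_of_prime_ne hpq
  simpa [ZMod.card, hp] using h1

theorem single_sub_single_mem_sumZero (i : Fin k) (x y : ZMod p) :
    (Pi.single i (Pi.single x 1 - Pi.single y 1) : Fin k → ZMod p → ZMod q) ∈ sumZero p q k := by
  intro j
  rcases eq_or_ne j i with rfl | hj
  · simp
  · simp [hj]

variable (p q k) in
/-- The polar form of the second elementary symmetric function on `sumZero p q k`. -/
def sumZeroForm : sumZero p q k →+ sumZero p q k →+ ZMod q :=
  AddMonoidHom.mk' (fun f => AddMonoidHom.mk' (fun g => -∑ i, ∑ x, f.1 i x * g.1 i x)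
    (fun g g' => by
      rw [← neg_add, ← Finset.sum_add_distrib]
      simp only [← Finset.sum_add_distrib, ← mul_add]
      rfl))
    (fun f f' => by
      ext g
      simp only [AddMonoidHom.mk'_apply, AddMonoidHom.add_apply]
      rw [← neg_add, ← Finset.sum_add_distrib]
      simp only [← Finset.sum_add_distrib, ← add_mul]
      rfl)

/-- The affine permutation `x ↦ χ (-z) * (x - c)` of `ℤ/(p)`. -/
def affinePerm (χ : Multiplicative (ZMod q) →* (ZMod p)ˣ) (c : ZMod p) (z : ZMod q) :
    Equiv.Perm (ZMod p) :=
  (Equiv.subRight c).trans (χ (Multiplicative.ofAdd (-z))).mulLeft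

theorem affinePerm_apply (χ : Multiplicative (ZMod q) →* (ZMod p)ˣ) (c : ZMod p) (z : ZMod q)
    (x : ZMod p) :
    affinePerm χ c z x = (χ (Multiplicative.ofAdd (-z)) : ZMod p) * (x - c) := rfl

/-- The permutation action of `ℤ/(p) ⋊ ℤ/(q)` on `sumZero p q k`. -/
def sumZeroAction (χ : Multiplicative (ZMod q) →* (ZMod p)ˣ) :
    OrthogonalAction p q (sumZero p q k) where
  χ z := χ (Multiplicative.ofAdd z)
  χ_zero := by simp
  χ_add z z' := by simp
  act c z :=
    { toFun := fun f => ⟨fun i x => f.1 i (affinePerm χ c z x), fun i => by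
        rw [Equiv.sum_comp (affinePerm χ c z) (f.1 i)]
        exact f.2 i⟩
      map_zero' := rfl
      map_add' := fun _ _ => rfl }
  act_zero t := by
    ext i x
    simp [affinePerm_apply]
  act_act c z c' z' t := by
    ext i x
    change t.1 i (affinePerm χ c' z' (affinePerm χ c z x)) = t.1 i (affinePerm χ _ _ x)
    refine congrArg (t.1 i) ?_
    have h : (χ (Multiplicative.ofAdd (-z)) : ZMod p) * χ (Multiplicative.ofAdd z) = 1 := by
      rw [← Units.val_mul, ← map_mul, ← ofAdd_add]
      simp
    simp only [affinePerm_apply, neg_add, ofAdd_add, map_mul, Units.val_mul]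
    linear_combination (χ (Multiplicative.ofAdd (-z')) : ZMod p) * c' * h
  Q f := ∑ i, esymmTwo Finset.univ (f.1 i)
  b := sumZeroForm p q k
  Q_add f g := by
    have h : ∀ i, esymmTwo Finset.univ ((f + g).1 i) = esymmTwo Finset.univ (f.1 i) +
        esymmTwo Finset.univ (g.1 i) + -∑ x, f.1 i x * g.1 i x := by
      intro i
      have h := esymmTwo_add Finset.univ (f.1 i) (g.1 i)
      rw [f.2 i, zero_mul, zero_sub] at h
      exact h
    change _ = _ + _ + -_
    rw [Finset.sum_congr rfl fun i _ => h i, Finset.sum_add_distrib, Finset.sum_add_distrib,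
      Finset.sum_neg_distrib]
  Q_act c z f := Finset.sum_congr rfl fun i _ =>
    esymmTwo_comp_equiv (affinePerm χ c z) (f.1 i)

variable (χ : Multiplicative (ZMod q) →* (ZMod p)ˣ)

theorem sumZeroAction_act_zero_apply (c : ZMod p) (f : sumZero p q k) (i : Fin k) (x : ZMod p) :
    ((sumZeroAction χ).act c 0 f).1 i x = f.1 i (x - c) := by
  change f.1 i (affinePerm χ c 0 x) = _
  simp [affinePerm_apply]

theorem sumZeroAction_b_apply (f g : sumZero p q k) :
    (sumZeroAction χ).b f g = -∑ i, ∑ x, f.1 i x * g.1 i x := rfl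

theorem sumZeroAction_nondegenerate (hpq : p ≠ q) (t : sumZero p q k) (ht : t ≠ 0) :
    ∃ s, (sumZeroAction χ).b s t ≠ 0 := by
  contrapose! ht
  refine Subtype.ext (sumZero_eq_zero hpq t.2 fun i x y => ?_)
  have h := ht ⟨_, single_sub_single_mem_sumZero i x y⟩
  rw [sumZeroAction_b_apply, neg_eq_zero, Finset.sum_eq_single i] at h
  · simpa [sub_mul, Pi.single_apply, Finset.sum_sub_distrib, sub_eq_zero] using h
  · intro j _ hj
    simp [hj]
  · simp

theorem sumZeroAction_faithful (hpq : p ≠ q) (hk : 1 ≤ k) (c : ZMod p) (hc : c ≠ 0) :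
    ∃ t : sumZero p q k, (sumZeroAction χ).act c 0 t ≠ t := by
  by_contra! h
  have hper : ∀ (t : sumZero p q k) i x (n : ℕ), t.1 i (x - n * c) = t.1 i x := by
    intro t i x n
    induction n with
    | zero => simp
    | succ n ih =>
      rw [← ih, ← congrFun (congrFun (congrArg Subtype.val (h t)) i) (x - n * c),
        sumZeroAction_act_zero_apply, sub_sub, Nat.cast_succ, add_one_mul]
  have hzero : ∀ t : sumZero p q k, t.1 = 0 := by
    intro t
    refine sumZero_eq_zero hpq t.2 fun i x y => ?_
    have := hper t i x ((x - y) / c).val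
    rw [← this]
    simp [hc]
  have h1 := congrFun (congrFun (hzero ⟨_, single_sub_single_mem_sumZero ⟨0, hk⟩ 0 1⟩) ⟨0, hk⟩) 0
  simp at h1

theorem sumZeroAction_coinvariants (hpq : p ≠ q) (J : AddSubgroup (sumZero p q k))
    (hJ : ∀ c t, t - (sumZeroAction χ).act c 0 t ∈ J) : J = ⊤ := by
  refine eq_top_iff.2 fun t _ => ?_
  have hp := natCast_ne_zero_of_prime_ne hpq
  have hsum : ∑ c : ZMod p, (t - (sumZeroAction χ).act c 0 t) = (p : ZMod q) • t := by
    ext i x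
    have h : ∑ c : ZMod p, t.1 i (x - c) = 0 := by
      exact (Equiv.sum_comp (Equiv.subLeft x) (t.1 i)).trans (t.2 i)
    simp [Finset.sum_apply, sumZeroAction_act_zero_apply, Finset.sum_sub_distrib, h]
  have hmem : (p : ZMod q) • t ∈ J := hsum ▸ J.sum_mem fun c _ => hJ c t
  have h := J.nsmul_mem hmem ((p : ZMod q)⁻¹).val
  rw [← Nat.cast_smul_eq_nsmul (ZMod q), smul_smul] at h
  simpa [hp] using h

end SumZero

theorem exists_character_ne_one {p q : ℕ} [Fact p.Prime] [Fact q.Prime] (hdvd : q ∣ p - 1) :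
    ∃ χ : Multiplicative (ZMod q) →* (ZMod p)ˣ, (χ (Multiplicative.ofAdd 1) : ZMod p) ≠ 1 := by
  obtain ⟨g, hg⟩ := exists_prime_orderOf_dvd_card (G := (ZMod p)ˣ) q
    (by rwa [ZMod.card_units])
  have hg' : zmultiplesHom _ (Additive.ofMul g) (q : ℤ) = 0 := by
    rw [zmultiplesHom_apply, natCast_zsmul, ← ofMul_pow, ← hg, pow_orderOf_eq_one, ofMul_one]
  let φ : ZMod q →+ Additive (ZMod p)ˣ := ZMod.lift q ⟨_, hg'⟩
  refine ⟨AddMonoidHom.toMultiplicativeLeft φ, fun h => ?_⟩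
  have h1 : φ 1 = Additive.ofMul g := by
    simpa using ZMod.lift_coe q ⟨_, hg'⟩ 1
  have h2 : g = 1 := by
    have : (φ 1).toMul = 1 := Units.ext h
    simpa [h1] using this
  rw [h2, orderOf_one] at hg
  exact (Fact.out : q.Prime).one_lt.ne hg

/-- Let `p₁, p₂` be primes with `p₂ ∣ p₁ − 1` and let `k ≥ 1`.  Then there exists a
simple left brace whose additive group is `ℤ/(p₁) × (ℤ/(p₂))^{k(p₁−1)+1}`; it is
non-trivial (its product differs from its sum) and of order `p₁ · p₂^{k(p₁−1)+1}`. -/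
theorem stmt19 (p₁ p₂ k : ℕ) (hp₁ : p₁.Prime) (hp₂ : p₂.Prime)
    (hdvd : p₂ ∣ p₁ - 1) (hk : 1 ≤ k) :
    ∃ mul : (ZMod p₁ × (Fin (k * (p₁ - 1) + 1) → ZMod p₂)) →
        (ZMod p₁ × (Fin (k * (p₁ - 1) + 1) → ZMod p₂)) →
        (ZMod p₁ × (Fin (k * (p₁ - 1) + 1) → ZMod p₂)),
      IsBraceMul mul ∧ IsSimpleBraceMul mul ∧
      (∃ a b : ZMod p₁ × (Fin (k * (p₁ - 1) + 1) → ZMod p₂), mul a b ≠ a + b) ∧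
      Nat.card (ZMod p₁ × (Fin (k * (p₁ - 1) + 1) → ZMod p₂))
        = p₁ * p₂ ^ (k * (p₁ - 1) + 1) := by
  have : Fact p₁.Prime := ⟨hp₁⟩
  have : Fact p₂.Prime := ⟨hp₂⟩
  have hpq : p₁ ≠ p₂ := by
    have := Nat.le_of_dvd (Nat.sub_pos_of_lt hp₁.one_lt) hdvd
    have := hp₁.one_lt
    omega
  obtain ⟨χ, hχ⟩ := exists_character_ne_one hdvd
  let D : OrthogonalAction p₁ p₂ (sumZero p₁ p₂ k) := sumZeroAction χ
  have hB := D.isBraceMul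
  have hS := D.isSimpleBraceMul hχ (sumZeroAction_nondegenerate χ hpq)
    (sumZeroAction_faithful χ hpq hk) (sumZeroAction_coinvariants χ hpq)
  let l : (sumZero p₁ p₂ k × ZMod p₂) ≃ₗ[ZMod p₂] (Fin (k * (p₁ - 1) + 1) → ZMod p₂) :=
    LinearEquiv.ofFinrankEq _ _ (by simp [finrank_sumZero])
  let e := (AddEquiv.refl (ZMod p₁)).prodCongr l.toAddEquiv
  refine ⟨_, hB.transport e, hS.transport e, ⟨e (0, 0, 1), e (1, 0, 0), fun h => ?_⟩, ?_⟩
  · rw [← map_add, e.injective.eq_iff] at h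
    simp only [AddEquiv.symm_apply_apply] at h
    refine hχ ?_
    have h1 := congrArg Prod.fst h
    have h2 : D.χ 1 = 1 := by
      simpa [OrthogonalAction.mul, OrthogonalAction.height, D.Q_zero] using h1
    exact h2
  · simp
end
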